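/- arXiv:2602.18718 — 2 statements merged into one kernel-verified Lean document; each statement's English description precedes it below -/
import Mathlib

section
/- Variance bound for the Bonnet–Price parameter gradient estimator (Lemma 3.4): Let λ = (m, C) and λ_* = (m_*, C_*) belong to Λ, suppose q_{λ_*} = N(m_*, C_*C_*ᵀ) satisfies the stationarity conditions ∫ ∇U dq_{λ_*} = 0 and ∫ ∇²U dq_{λ_*} = (C_*C_*ᵀ)^{-1}, and let ψ be any coupling of q_λ and q_{λ_*}. Then E_{ε∼N(0,I)}[ ‖∇U(Cε + m) − ∫ ∇U dq_{λ_*}‖² + ‖Cᵀ∇²U(Cε + m) − C_*ᵀ ∫ ∇²U dq_{λ_*}‖_F² ] ≤ 10Lκ · ∫ D_U(x, x_*) dψ(x, x_*) + 10dL. -/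
open MeasureTheory Matrix Real
open scoped RealInnerProductSpace

noncomputable section

/-- `ℝ^d` as a Euclidean space. -/
abbrev Vec (d : ℕ) := EuclideanSpace ℝ (Fin d)

/-- `d × d` real matrices. -/
abbrev Mat (d : ℕ) := Matrix (Fin d) (Fin d) ℝ

variable {d : ℕ}

/-- Matrix-vector product as a map on Euclidean space. -/
def matVec (A : Mat d) (x : Vec d) : Vec d :=
  (EuclideanSpace.equiv (Fin d) ℝ).symm (A.mulVec (EuclideanSpace.equiv (Fin d) ℝ x))

/-- The Gaussian measure `N(m, S)` on `ℝ^d` with mean `m` and covariance `S`,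
defined via its density with respect to Lebesgue measure.  (For `S` positive
definite this is the usual Gaussian probability measure.) -/
def gaussian (m : Vec d) (S : Mat d) : Measure (Vec d) :=
  volume.withDensity fun x =>
    ENNReal.ofReal (Real.sqrt (((2 * π) ^ d * S.det)⁻¹) *
      Real.exp (-⟪x - m, matVec S⁻¹ (x - m)⟫ / 2))

/-- The Hessian of `f : ℝ^d → ℝ` at `x`, as a `d × d` matrix. -/
def hess (f : Vec d → ℝ) (x : Vec d) : Mat d :=
  Matrix.of fun i j =>
    fderiv ℝ (fun y => fderiv ℝ f y (EuclideanSpace.single j 1)) x (EuclideanSpace.single i 1)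

/-- Frobenius norm of a matrix. -/
def frobNorm (A : Mat d) : ℝ := Real.sqrt (∑ i, ∑ j, (A i j) ^ 2)

/-- Squared Frobenius norm of a matrix. -/
def frobSq (A : Mat d) : ℝ := ∑ i, ∑ j, (A i j) ^ 2

/-- Jacobian of `g : ℝ^d → ℝ^d` at `x`: `(jacobian g x) i j = ∂ g_j / ∂ x_i`. -/
def jacobian (g : Vec d → Vec d) (x : Vec d) : Mat d :=
  Matrix.of fun i j => fderiv ℝ (fun y => g y j) x (EuclideanSpace.single i 1)

/-- Integral of the gradient of `U` against a measure. -/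
def intGrad (U : Vec d → ℝ) (q : Measure (Vec d)) : Vec d := ∫ x, gradient U x ∂q

/-- Entrywise integral of the Hessian of `U` against a measure. -/
def intHess (U : Vec d → ℝ) (q : Measure (Vec d)) : Mat d :=
  Matrix.of fun i j => ∫ x, hess U x i j ∂q

/-- The variational free energy of the Gaussian `N(m,S)`:
`F(m,Σ) = ∫ U dN(m,Σ) − (1/2)·log((2πe)^d · det Σ)`. -/
def freeEnergy (U : Vec d → ℝ) (m : Vec d) (S : Mat d) : ℝ :=
  (∫ x, U x ∂(gaussian m S)) - (1 / 2) * Real.log ((2 * π * Real.exp 1) ^ d * S.det)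

/-- Bregman divergence of `U`: `D_U(x,y) = U(x) − U(y) − ⟨∇U(y), x − y⟩`. -/
def bregman (U : Vec d → ℝ) (x y : Vec d) : ℝ := U x - U y - ⟪gradient U y, x - y⟫

/-- `ψ` is a coupling of `p` and `q`: a probability measure on the product whose
marginals are `p` and `q`. -/
def IsCoupling (ψ : Measure (Vec d × Vec d)) (p q : Measure (Vec d)) : Prop :=
  IsProbabilityMeasure ψ ∧ ψ.map Prod.fst = p ∧ ψ.map Prod.snd = q

/-- Membership in the parameter space `Λ`: `C` is lower triangular with strictly
positive diagonal. -/
def memLambda (m : Vec d) (C : Mat d) : Prop :=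
  (∀ i j : Fin d, i < j → C i j = 0) ∧ ∀ i, 0 < C i i

/-- A function whose second derivative is at least `c` lies above its second-order Taylor bound. -/
lemma taylor_lower_bound {f f' f'' : ℝ → ℝ} {c : ℝ} (hf : ∀ t, HasDerivAt f (f' t) t)
    (hf' : ∀ t, HasDerivAt f' (f'' t) t) (hc : ∀ t, c ≤ f'' t) :
    f 0 + f' 0 + c / 2 ≤ f 1 := by
  have h1 : Monotone fun t => f' t - c * t :=
    monotone_of_hasDerivAt_nonneg (f' := fun t => f'' t - c)
      (fun t => ((hf' t).sub ((hasDerivAt_id t).const_mul c)).congr_deriv (by simp))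
      (fun t => sub_nonneg.2 (hc t))
  have hd : ∀ t, HasDerivAt (fun t => f t - f' 0 * t - c / 2 * t ^ 2)
      (f' t - f' 0 - c * t) t := fun t => by
    refine (((hf t).sub ((hasDerivAt_id t).const_mul (f' 0))).sub
      ((hasDerivAt_pow 2 t).const_mul (c / 2))).congr_deriv ?_
    simp
    ring
  have h2 : MonotoneOn (fun t => f t - f' 0 * t - c / 2 * t ^ 2) (Set.Ici 0) := by
    refine monotoneOn_of_deriv_nonneg (convex_Ici 0)
      (fun t _ => (hd t).continuousAt.continuousWithinAt)
      (fun t _ => (hd t).differentiableAt.differentiableWithinAt) fun t ht => ?_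
    rw [interior_Ici] at ht
    rw [(hd t).deriv]
    have := h1 (le_of_lt ht)
    simp only at this
    linarith
  have := h2 (Set.mem_Ici.2 le_rfl) (Set.mem_Ici.2 zero_le_one) zero_le_one
  simp only at this
  linarith

lemma inner_gradient (U : Vec d → ℝ) (x v : Vec d) : ⟪gradient U x, v⟫ = fderiv ℝ U x v := by
  rw [← toDual_gradient]
  simp

lemma hess_apply {U : Vec d → ℝ} (hU : ContDiff ℝ 2 U) (x : Vec d) (i j : Fin d) :
    hess U x i j =
      fderiv ℝ (fderiv ℝ U) x (EuclideanSpace.single i 1) (EuclideanSpace.single j 1) := by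
  have h : DifferentiableAt ℝ (fderiv ℝ U) x :=
    (hU.fderiv_right (m := 1) (by norm_num)).differentiable one_ne_zero x
  simp only [hess, Matrix.of_apply]
  rw [fderiv_clm_apply h (differentiableAt_const _)]
  simp

lemma matVec_eq_toEuclideanCLM (A : Mat d) (x : Vec d) :
    matVec A x = Matrix.toEuclideanCLM (n := Fin d) (𝕜 := ℝ) A x := rfl

lemma ofLp_matVec (A : Mat d) (x : Vec d) : (matVec A x).ofLp = A *ᵥ x.ofLp := rfl

lemma dotProduct_hess {U : Vec d → ℝ} (hU : ContDiff ℝ 2 U) (x v w : Vec d) :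
    v.ofLp ⬝ᵥ (hess U x *ᵥ w.ofLp) = fderiv ℝ (fderiv ℝ U) x v w := by
  have hv : ∀ v : Vec d, v = ∑ i, v.ofLp i • EuclideanSpace.single i (1 : ℝ) := fun v => by
    simpa using ((EuclideanSpace.basisFun (Fin d) ℝ).sum_repr v).symm
  conv_rhs => rw [hv v, hv w]
  simp only [map_sum, map_smul, _root_.sum_apply, _root_.smul_apply,
    smul_eq_mul, dotProduct, mulVec, hess_apply hU, Finset.mul_sum]
  refine (Finset.sum_comm).trans (Finset.sum_congr rfl fun i _ => Finset.sum_congr rfl fun j _ => ?_)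
  ring

lemma continuous_gradient {U : Vec d → ℝ} (hU : ContDiff ℝ 2 U) : Continuous (gradient U) :=
  (InnerProductSpace.toDual ℝ (Vec d)).symm.continuous.comp
    (hU.continuous_fderiv two_ne_zero)

lemma continuous_hess {U : Vec d → ℝ} (hU : ContDiff ℝ 2 U) : Continuous (hess U) := by
  have h : Continuous (fderiv ℝ (fderiv ℝ U)) :=
    (hU.fderiv_right (m := 1) (by norm_num)).continuous_fderiv one_ne_zero
  refine continuous_matrix fun i j => ?_
  simp only [hess_apply hU]
  fun_prop

section Convexity

variable {U : Vec d → ℝ} {μ L : ℝ}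

/-- A Hessian bounded below by `μ` makes the Bregman divergence at least `μ / 2 * ‖x - y‖ ^ 2`. -/
lemma bregman_lower_bound (hU : ContDiff ℝ 2 U)
    (h : ∀ x v, μ * ‖v‖ ^ 2 ≤ fderiv ℝ (fderiv ℝ U) x v v) (x y : Vec d) :
    μ / 2 * ‖x - y‖ ^ 2 ≤ bregman U x y := by
  have hl : ∀ t : ℝ, HasDerivAt (fun t : ℝ => y + t • (x - y)) (x - y) t := fun t => by
    simpa using ((hasDerivAt_id t).smul_const (x - y)).const_add y
  have h1 : ∀ t : ℝ, HasDerivAt (fun t : ℝ => U (y + t • (x - y)))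
      (fderiv ℝ U (y + t • (x - y)) (x - y)) t := fun t =>
    ((hU.differentiable two_ne_zero _).hasFDerivAt.comp_hasDerivAt t (hl t))
  have h2 : ∀ t : ℝ, HasDerivAt (fun t : ℝ => fderiv ℝ U (y + t • (x - y)) (x - y))
      (fderiv ℝ (fderiv ℝ U) (y + t • (x - y)) (x - y) (x - y)) t := fun t => by
    have hd := ((hU.fderiv_right (m := 1) (by norm_num)).differentiable one_ne_zero
      (y + t • (x - y))).hasFDerivAt.comp_hasDerivAt t (hl t)
    simpa using hd.clm_apply (hasDerivAt_const t (x - y))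
  have := taylor_lower_bound h1 h2 (fun t => h _ _)
  simp only [zero_smul, add_zero, one_smul, add_sub_cancel] at this
  rw [bregman, inner_gradient]
  linarith

lemma bregman_upper_bound (hU : ContDiff ℝ 2 U)
    (h : ∀ x v, fderiv ℝ (fderiv ℝ U) x v v ≤ L * ‖v‖ ^ 2) (x y : Vec d) :
    bregman U x y ≤ L / 2 * ‖x - y‖ ^ 2 := by
  have h1 : fderiv ℝ (fun z => -U z) = fun z => -fderiv ℝ U z := by
    ext1 z
    exact fderiv_fun_neg
  have := bregman_lower_bound (U := fun z => -U z) (μ := -L) hU.neg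
    (fun x v => by
      have h2 : fderiv ℝ (fun z => -fderiv ℝ U z) x = -fderiv ℝ (fderiv ℝ U) x := fderiv_fun_neg
      rw [h1, h2]
      simpa using h x v) x y
  simp only [bregman, inner_gradient, h1, _root_.neg_apply] at this ⊢
  linarith

lemma bregman_cocoercive (hL : 0 < L) (hbelow : ∀ x y, 0 ≤ bregman U x y)
    (habove : ∀ x y, bregman U x y ≤ L / 2 * ‖x - y‖ ^ 2) (x y : Vec d) :
    ‖gradient U x - gradient U y‖ ^ 2 ≤ 2 * L * bregman U x y := by
  set G := gradient U x - gradient U y with hG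
  set z := x - L⁻¹ • G with hz
  have h1 := hbelow z y
  have h2 := habove z x
  have h3 : z - x = -(L⁻¹ • G) := by rw [hz]; abel
  have h4 : bregman U x y = bregman U z y - bregman U z x - ⟪G, z - x⟫ := by
    simp only [bregman, hG, inner_sub_left, inner_sub_right]
    ring
  have h5 : ⟪G, z - x⟫ = -(L⁻¹ * ‖G‖ ^ 2) := by
    rw [h3, inner_neg_right, real_inner_smul_right, real_inner_self_eq_norm_sq]
  have h6 : ‖z - x‖ ^ 2 = L⁻¹ ^ 2 * ‖G‖ ^ 2 := by
    rw [h3, norm_neg, norm_smul, mul_pow, Real.norm_eq_abs, sq_abs]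
  have h7 : L⁻¹ / 2 * ‖G‖ ^ 2 ≤ bregman U x y := by
    rw [h6] at h2
    have : L / 2 * (L⁻¹ ^ 2 * ‖G‖ ^ 2) = L⁻¹ / 2 * ‖G‖ ^ 2 := by field_simp
    linarith
  calc ‖G‖ ^ 2 = 2 * L * (L⁻¹ / 2 * ‖G‖ ^ 2) := by field_simp
    _ ≤ _ := by gcongr

lemma bregman_add_bregman_swap (x y : Vec d) :
    bregman U x y + bregman U y x = ⟪gradient U x - gradient U y, x - y⟫ := by
  simp only [bregman, inner_sub_left, inner_sub_right]
  ring

/-- The pointwise inequality that, once integrated against the coupling, yields the variance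
bound. -/
lemma gradient_pointwise_bound (hμ : 0 < μ) (hμL : μ ≤ L)
    (hbelow : ∀ x y, μ / 2 * ‖x - y‖ ^ 2 ≤ bregman U x y)
    (habove : ∀ x y, bregman U x y ≤ L / 2 * ‖x - y‖ ^ 2) (m n x y : Vec d) :
    ‖gradient U x‖ ^ 2 + 2 * L * ⟪gradient U x, x - m⟫ ≤
      10 * L * (L / μ) * bregman U x y + 8 * L * ⟪gradient U y, y - n⟫
        - 6 * L * ⟪gradient U n, y - n⟫ + 8 * ⟪gradient U n, gradient U y⟫
        - 3 * L ^ 2 * (⟪m - n, x - m⟫ - ⟪m - n, y - n⟫) := by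
  have hL : 0 < L := hμ.trans_le hμL
  have hco := bregman_cocoercive hL (fun x y => (by positivity : (0 : ℝ) ≤ _).trans (hbelow x y))
    habove
  set D := bregman U x y
  set G := gradient U x - gradient U y with hG
  set Z := y - n with hZ
  set Y := x - m - Z with hY
  set b := gradient U y with hb
  set a := gradient U n with ha
  have hD : 0 ≤ D := (by positivity : (0 : ℝ) ≤ _).trans (hbelow x y)
  have hsplit : ⟪gradient U x, x - m⟫ = ⟪G, Y⟫ + ⟪G, Z⟫ + ⟪b, Y⟫ + ⟪b, Z⟫ := by
    have h1 : gradient U x = G + b := by rw [hG]; abel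
    have h2 : x - m = Y + Z := by rw [hY]; abel
    rw [h1, h2, inner_add_left, inner_add_right, inner_add_right]
    ring
  have hmean : ⟪m - n, x - m⟫ - ⟪m - n, y - n⟫ = ⟪m - n, Y⟫ := by
    rw [hY, inner_sub_right _ (x - m)]
  have hgx : ‖gradient U x‖ ^ 2 ≤ 2 * ‖G‖ ^ 2 + 2 * ‖b‖ ^ 2 := by
    have h1 : gradient U x = G + b := by rw [hG]; abel
    have h2 := norm_add_sq_real G b
    have h3 := norm_sub_sq_real G b
    rw [h1]
    nlinarith [sq_nonneg ‖G - b‖]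
  have young (s : ℝ) (u v : Vec d) : 2 * s * ⟪u, v⟫ ≤ ‖u‖ ^ 2 + s ^ 2 * ‖v‖ ^ 2 := by
    have h := norm_sub_sq_real u (s • v)
    rw [real_inner_smul_right, norm_smul, mul_pow, Real.norm_eq_abs, sq_abs] at h
    nlinarith [sq_nonneg ‖u - s • v‖]
  have hGY := young L G Y
  have hGZ : 2 * L * ⟪G, Z⟫ ≤ L / (2 * μ) * ‖G‖ ^ 2 + 2 * L * (μ * ‖Z‖ ^ 2) := by
    calc 2 * L * ⟪G, Z⟫ = L / (2 * μ) * (2 * (2 * μ) * ⟪G, Z⟫) := by field_simp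
      _ ≤ L / (2 * μ) * (‖G‖ ^ 2 + (2 * μ) ^ 2 * ‖Z‖ ^ 2) := by gcongr; exact young _ _ _
      _ = _ := by field_simp
  have hbY : 2 * L * ⟪b, Y⟫ ≤ 2 * ‖b‖ ^ 2 + L ^ 2 / 2 * ‖Y‖ ^ 2 := by
    have := young (L / 2) b Y
    nlinarith
  have hYD : ‖Y‖ ^ 2 ≤ 2 / μ * D - 2 * ⟪m - n, Y⟫ := by
    have h1 : x - y = Y + (m - n) := by rw [hY, hZ]; abel
    have h2 := norm_add_sq_real Y (m - n)
    have h3 : ‖x - y‖ ^ 2 ≤ 2 / μ * D := by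
      calc ‖x - y‖ ^ 2 = 2 / μ * (μ / 2 * ‖x - y‖ ^ 2) := by field_simp
        _ ≤ _ := by gcongr; exact hbelow x y
    rw [h1] at h3
    rw [real_inner_comm] at h2
    nlinarith [sq_nonneg ‖m - n‖]
  have hswap : bregman U y n + bregman U n y = ⟪b, Z⟫ - ⟪a, Z⟫ := by
    rw [bregman_add_bregman_swap, inner_sub_left]
  have hbn : ‖b‖ ^ 2 ≤ L * (⟪b, Z⟫ - ⟪a, Z⟫) + 2 * ⟪a, b⟫ := by
    have h1 := hco y n
    have h2 := hco n y
    rw [norm_sub_rev] at h2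
    have h3 := norm_sub_sq_real b a
    rw [real_inner_comm] at h3
    rw [← hswap]
    nlinarith [sq_nonneg ‖a‖]
  have hZn : μ * ‖Z‖ ^ 2 ≤ ⟪b, Z⟫ - ⟪a, Z⟫ := by
    have h1 := hbelow y n
    have h2 := hbelow n y
    rw [norm_sub_rev] at h2
    linarith
  have hGD := hco x y
  have hκ : L * D ≤ L * (L / μ) * D := by
    have : 1 ≤ L / μ := (one_le_div hμ).2 hμL
    nlinarith [mul_nonneg hL.le hD]
  have e1 : L / (2 * μ) * ‖G‖ ^ 2 ≤ L * (L / μ) * D := by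
    calc L / (2 * μ) * ‖G‖ ^ 2 ≤ L / (2 * μ) * (2 * L * D) := by gcongr
      _ = _ := by field_simp
  have e2 : L ^ 2 * ‖Y‖ ^ 2 ≤ 2 * (L * (L / μ) * D) - 2 * L ^ 2 * ⟪m - n, Y⟫ := by
    calc L ^ 2 * ‖Y‖ ^ 2 ≤ L ^ 2 * (2 / μ * D - 2 * ⟪m - n, Y⟫) := by gcongr
      _ = _ := by field_simp
  have e3 := mul_le_mul_of_nonneg_left hZn hL.le
  rw [hsplit, hmean]
  linarith

end Convexity
section Gaussian

lemma det_ne_zero_of_memLambda {m : Vec d} {C : Mat d} (h : memLambda m C) : C.det ≠ 0 := by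
  rw [Matrix.det_of_isLowerTriangular]
  · exact Finset.prod_ne_zero_iff.2 fun i _ => (h.2 i).ne'
  · exact fun i j hij => h.1 i j hij

lemma continuous_matVec (A : Mat d) : Continuous (matVec A) :=
  (Matrix.toEuclideanCLM (n := Fin d) (𝕜 := ℝ) A).continuous

lemma gaussian_zero_one : gaussian (0 : Vec d) 1 = volume.withDensity fun x =>
    ENNReal.ofReal (Real.sqrt (((2 * π) ^ d)⁻¹) * Real.exp (-‖x‖ ^ 2 / 2)) := by
  simp only [gaussian, inv_one, det_one, mul_one, sub_zero]
  congr! 5 with x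
  rw [show matVec 1 x = x by simp [matVec_eq_toEuclideanCLM], real_inner_self_eq_norm_sq]

/-- The Gaussian `N(m, CCᵀ)` is the law of `Cε + m` for standard Gaussian `ε`. -/
lemma map_gaussian (m : Vec d) {C : Mat d} (hC : C.det ≠ 0) :
    (gaussian (0 : Vec d) 1).map (fun e => matVec C e + m) = gaussian m (C * Cᵀ) := by
  set A := Matrix.toEuclideanCLM (n := Fin d) (𝕜 := ℝ) C with hA
  have hT : Continuous fun e => matVec C e + m := (continuous_matVec C).add continuous_const
  have hinv (v : Vec d) : matVec C (matVec C⁻¹ v) = v := by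
    apply (WithLp.ofLp_injective 2)
    rw [ofLp_matVec, ofLp_matVec, mulVec_mulVec, mul_nonsing_inv _ (isUnit_iff_ne_zero.2 hC),
      one_mulVec]
  have hinv' (v : Vec d) : matVec C⁻¹ (matVec C v) = v := by
    apply (WithLp.ofLp_injective 2)
    rw [ofLp_matVec, ofLp_matVec, mulVec_mulVec, nonsing_inv_mul _ (isUnit_iff_ne_zero.2 hC),
      one_mulVec]
  have hinj : Function.Injective fun e => matVec C e + m := fun x y hxy => by
    have h : matVec C x = matVec C y := add_right_cancel hxy
    rw [← hinv' x, h, hinv']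
  have hsurj : Function.Surjective fun e => matVec C e + m := fun y =>
    ⟨matVec C⁻¹ (y - m), by simp [hinv]⟩
  have hderiv (x : Vec d) : HasFDerivAt (fun e => matVec C e + m) A x :=
    A.hasFDerivAt.add_const m
  have hdet : A.det = C.det := by
    rw [ContinuousLinearMap.det, hA, coe_toEuclideanCLM_eq_toEuclideanLin,
      toEuclideanLin_eq_toLin_orthonormal, LinearMap.det_toLin]
  have hquad (x : Vec d) : ⟪matVec C x, matVec (C * Cᵀ)⁻¹ (matVec C x)⟫ = ‖x‖ ^ 2 := by
    rw [← real_inner_self_eq_norm_sq, EuclideanSpace.inner_eq_star_dotProduct,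
      EuclideanSpace.inner_eq_star_dotProduct, ofLp_matVec, ofLp_matVec, star_trivial,
      star_trivial, Matrix.mul_inv_rev, mulVec_mulVec, Matrix.mul_assoc,
      nonsing_inv_mul _ (isUnit_iff_ne_zero.2 hC), Matrix.mul_one, dotProduct_mulVec,
      vecMul_mulVec, ← transpose_nonsing_inv, transpose_transpose,
      nonsing_inv_mul _ (isUnit_iff_ne_zero.2 hC), vecMul_one]
  ext s hs
  rw [Measure.map_apply hT.measurable hs, gaussian_zero_one, gaussian,
    withDensity_apply _ (hT.measurable hs), withDensity_apply _ hs]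
  conv_rhs => rw [← Set.image_preimage_eq s hsurj]
  rw [lintegral_image_eq_lintegral_abs_det_fderiv_mul volume (hT.measurable hs)
    (fun x _ => (hderiv x).hasFDerivWithinAt) hinj.injOn]
  refine lintegral_congr fun x => ?_
  rw [hdet, ← ENNReal.ofReal_mul (abs_nonneg _), ← mul_assoc, add_sub_cancel_right, hquad,
    det_mul, det_transpose, mul_inv, Real.sqrt_mul (by positivity), mul_inv,
    Real.sqrt_mul_self_eq_abs, abs_inv, mul_left_comm, mul_inv_cancel₀ (abs_ne_zero.2 hC), mul_one]

lemma integrable_mul_exp_neg_sq_norm {f : Vec d → ℝ} (hf : Continuous f) {K : ℝ}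
    (hK : ∀ x, |f x| ≤ K * (1 + ‖x‖ ^ 2)) :
    Integrable fun x => f x * Real.exp (-‖x‖ ^ 2 / 2) := by
  have hexp : Integrable fun x : Vec d => Real.exp (-(1 / 4) * ‖x‖ ^ 2) := by
    have := (GaussianFourier.integrable_cexp_neg_mul_sq_norm_add (V := Vec d) (b := (1 / 4 : ℂ))
      (by norm_num) 0 0).norm
    refine this.congr (ae_of_all _ fun x => ?_)
    simp only [Complex.norm_exp]
    congr 1
    norm_num [← Complex.ofReal_pow]
  refine (hexp.const_mul (4 * K)).mono' (by fun_prop) (ae_of_all _ fun x => ?_)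
  have hK0 : 0 ≤ K := by simpa using (abs_nonneg _).trans (hK 0)
  have h1 : 1 + ‖x‖ ^ 2 ≤ 4 * Real.exp (‖x‖ ^ 2 / 4) := by
    linarith [Real.add_one_le_exp (‖x‖ ^ 2 / 4)]
  have h2 : Real.exp (-‖x‖ ^ 2 / 2)
      = Real.exp (-(1 / 4) * ‖x‖ ^ 2) * Real.exp (-(‖x‖ ^ 2 / 4)) := by
    rw [← Real.exp_add]
    congr 1
    ring
  rw [norm_mul, Real.norm_eq_abs, Real.norm_eq_abs, Real.abs_exp]
  calc |f x| * Real.exp (-‖x‖ ^ 2 / 2)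
      ≤ K * (4 * Real.exp (‖x‖ ^ 2 / 4)) * Real.exp (-‖x‖ ^ 2 / 2) := by
        gcongr
        exact (hK x).trans (by gcongr)
    _ = 4 * K * Real.exp (-(1 / 4) * ‖x‖ ^ 2) := by
        rw [h2, Real.exp_neg (‖x‖ ^ 2 / 4)]
        field_simp

lemma integral_gaussian_zero_one (f : Vec d → ℝ) :
    ∫ x, f x ∂(gaussian (0 : Vec d) 1) =
      Real.sqrt (((2 * π) ^ d)⁻¹) * ∫ x, f x * Real.exp (-‖x‖ ^ 2 / 2) := by
  rw [gaussian_zero_one, integral_withDensity_eq_integral_toReal_smul (by fun_prop)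
    (ae_of_all _ fun _ => ENNReal.ofReal_lt_top), ← integral_const_mul]
  refine integral_congr_ae (ae_of_all _ fun x => ?_)
  simp only [smul_eq_mul]
  rw [ENNReal.toReal_ofReal (by positivity)]
  ring

lemma integrable_gaussian_zero_one {f : Vec d → ℝ} (hf : Continuous f) {K : ℝ}
    (hK : ∀ x, |f x| ≤ K * (1 + ‖x‖ ^ 2)) : Integrable f (gaussian (0 : Vec d) 1) := by
  rw [gaussian_zero_one, integrable_withDensity_iff (by fun_prop)
    (ae_of_all _ fun _ => ENNReal.ofReal_lt_top)]
  refine ((integrable_mul_exp_neg_sq_norm hf hK).const_mul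
    (Real.sqrt (((2 * π) ^ d)⁻¹))).congr (ae_of_all _ fun x => ?_)
  simp only
  rw [ENNReal.toReal_ofReal (by positivity)]
  ring

/-- A continuous function of at most quadratic growth is integrable against a Gaussian. -/
lemma integrable_gaussian (m : Vec d) {C : Mat d} (hC : C.det ≠ 0) {f : Vec d → ℝ}
    (hf : Continuous f) {K : ℝ} (hK : ∀ x, |f x| ≤ K * (1 + ‖x‖ ^ 2)) :
    Integrable f (gaussian m (C * Cᵀ)) := by
  have hT : Continuous fun e => matVec C e + m := (continuous_matVec C).add continuous_const
  rw [← map_gaussian m hC, integrable_map_measure hf.aestronglyMeasurable hT.aemeasurable]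
  have hK0 : 0 ≤ K := by simpa using (abs_nonneg _).trans (hK 0)
  set A := Matrix.toEuclideanCLM (n := Fin d) (𝕜 := ℝ) C
  refine integrable_gaussian_zero_one (K := K * (1 + 2 * ‖A‖ ^ 2 + 2 * ‖m‖ ^ 2)) (hf.comp hT)
    fun e => (hK _).trans ?_
  rw [mul_assoc]
  gcongr
  have h1 : ‖matVec C e + m‖ ≤ ‖A‖ * ‖e‖ + ‖m‖ :=
    (norm_add_le _ _).trans (by gcongr; exact A.le_opNorm e)
  have h2 : ‖matVec C e + m‖ ^ 2 ≤ (‖A‖ * ‖e‖ + ‖m‖) ^ 2 := by gcongr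
  nlinarith [sq_nonneg (‖A‖ * ‖e‖ - ‖m‖), mul_nonneg (sq_nonneg ‖m‖) (sq_nonneg ‖e‖),
    sq_nonneg ‖A‖, sq_nonneg ‖e‖]

lemma abs_mul_inner_le {f : Vec d → ℝ} {K : ℝ} (hK : ∀ x, |f x| ≤ K * (1 + ‖x‖)) (v x : Vec d) :
    |f x * ⟪v, x⟫| ≤ 2 * (K * ‖v‖) * (1 + ‖x‖ ^ 2) := by
  have hK0 : 0 ≤ K := by simpa using (abs_nonneg _).trans (hK 0)
  rw [abs_mul]
  calc |f x| * |⟪v, x⟫| ≤ (K * (1 + ‖x‖)) * (‖v‖ * ‖x‖) := by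
        gcongr
        exacts [hK x, abs_real_inner_le_norm v x]
    _ = K * ‖v‖ * ((1 + ‖x‖) * ‖x‖) := by ring
    _ ≤ K * ‖v‖ * (2 * (1 + ‖x‖ ^ 2)) :=
        mul_le_mul_of_nonneg_left (by nlinarith [sq_nonneg (‖x‖ - 1)]) (by positivity)
    _ = _ := by ring

/-- Gaussian integration by parts (Stein's identity) in a coordinate direction. -/
lemma stein_gaussian_zero_one {f : Vec d → ℝ} (hf : ContDiff ℝ 1 f) {K : ℝ}
    (hK : ∀ x, |f x| ≤ K * (1 + ‖x‖)) {v : Vec d} {K' : ℝ} (hK' : ∀ x, |fderiv ℝ f x v| ≤ K') :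
    ∫ x, f x * ⟪v, x⟫ ∂(gaussian (0 : Vec d) 1) =
      ∫ x, fderiv ℝ f x v ∂(gaussian (0 : Vec d) 1) := by
  have hK0 : 0 ≤ K := by simpa using (abs_nonneg _).trans (hK 0)
  have hK0' : 0 ≤ K' := by simpa using (abs_nonneg _).trans (hK' 0)
  have hderiv (x : Vec d) : HasFDerivAt (fun x : Vec d => Real.exp (-‖x‖ ^ 2 / 2))
      (Real.exp (-‖x‖ ^ 2 / 2) • -(innerSL ℝ x)) x := by
    have h := ((hasStrictFDerivAt_norm_sq x).hasFDerivAt.const_mul (-1 / 2 : ℝ)).exp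
    have e : ∀ y : Vec d, -1 / 2 * ‖y‖ ^ 2 = -‖y‖ ^ 2 / 2 := fun y => by ring
    simp only [e] at h
    refine h.congr_fderiv ?_
    ext v
    simp
    ring
  have hparts := integral_mul_fderiv_eq_neg_fderiv_mul_of_integrable (μ := (volume : Measure (Vec d)))
    (f := f) (g := fun x : Vec d => Real.exp (-‖x‖ ^ 2 / 2)) (v := v) ?_ ?_ ?_
    (fun x _ => hf.differentiable one_ne_zero x) (fun x _ => (hderiv x).differentiableAt)
  · rw [integral_gaussian_zero_one, integral_gaussian_zero_one]
    congr 1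
    rw [← neg_inj, ← hparts, ← integral_neg]
    refine integral_congr_ae (ae_of_all _ fun x => ?_)
    simp only [(hderiv x).fderiv]
    simp [real_inner_comm]
    ring
  · refine integrable_mul_exp_neg_sq_norm (K := K')
      ((hf.continuous_fderiv one_ne_zero).clm_apply continuous_const) fun x => (hK' x).trans ?_
    nlinarith [mul_nonneg hK0' (sq_nonneg ‖x‖)]
  · refine (integrable_mul_exp_neg_sq_norm (K := 2 * (K * ‖v‖))
      (f := fun x => -(f x * ⟪v, x⟫)) (by have := hf.continuous; fun_prop) fun x => ?_).congr
      (ae_of_all _ fun x => ?_)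
    · rw [abs_neg]
      exact abs_mul_inner_le hK v x
    · simp only [(hderiv x).fderiv]
      simp [real_inner_comm]
      ring
  · refine integrable_mul_exp_neg_sq_norm (K := 2 * K) hf.continuous fun x => (hK x).trans ?_
    rw [mul_comm 2 K, mul_assoc]
    refine mul_le_mul_of_nonneg_left ?_ hK0
    nlinarith [sq_nonneg (‖x‖ - 1)]

end Gaussian
section LinearGrowth

/-- Inner products of continuous maps of at most linear growth are integrable against Gaussians. -/
lemma integrable_inner_gaussian (m : Vec d) {C : Mat d} (hC : C.det ≠ 0) {u v : Vec d → Vec d}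
    (hu : Continuous u) (hv : Continuous v) {K K' : ℝ} (hK : ∀ x, ‖u x‖ ≤ K * (1 + ‖x‖))
    (hK' : ∀ x, ‖v x‖ ≤ K' * (1 + ‖x‖)) :
    Integrable (fun x => ⟪u x, v x⟫) (gaussian m (C * Cᵀ)) := by
  have hK0 : 0 ≤ K := by simpa using (norm_nonneg _).trans (hK 0)
  have hK0' : 0 ≤ K' := by simpa using (norm_nonneg _).trans (hK' 0)
  refine integrable_gaussian m hC (K := 2 * (K * K')) (hu.inner hv) fun x => ?_
  calc |⟪u x, v x⟫| ≤ (K * (1 + ‖x‖)) * (K' * (1 + ‖x‖)) :=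
        (abs_real_inner_le_norm _ _).trans (by gcongr; exacts [hK x, hK' x])
    _ = K * K' * (1 + ‖x‖) ^ 2 := by ring
    _ ≤ K * K' * (2 * (1 + ‖x‖ ^ 2)) :=
        mul_le_mul_of_nonneg_left (by nlinarith [sq_nonneg (‖x‖ - 1)]) (by positivity)
    _ = _ := by ring

lemma norm_sub_const_le (m x : Vec d) : ‖x - m‖ ≤ (1 + ‖m‖) * (1 + ‖x‖) := by
  have := norm_sub_le x m
  nlinarith [mul_nonneg (norm_nonneg m) (norm_nonneg x)]

lemma norm_const_le (a x : Vec d) : ‖a‖ ≤ ‖a‖ * (1 + ‖x‖) := by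
  nlinarith [mul_nonneg (norm_nonneg a) (norm_nonneg x)]

lemma integral_gaussian_eq (m : Vec d) {C : Mat d} (hC : C.det ≠ 0) {f : Vec d → ℝ}
    (hf : Continuous f) : ∫ x, f x ∂(gaussian m (C * Cᵀ)) =
      ∫ e, f (matVec C e + m) ∂(gaussian (0 : Vec d) 1) := by
  have hT : Continuous fun e => matVec C e + m := (continuous_matVec C).add continuous_const
  rw [← map_gaussian m hC, integral_map hT.aemeasurable hf.aestronglyMeasurable]

/-- The mean of `N(m, CCᵀ)` is `m`. -/
lemma integral_inner_sub_gaussian (a m : Vec d) {C : Mat d} (hC : C.det ≠ 0) :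
    ∫ x, ⟪a, x - m⟫ ∂(gaussian m (C * Cᵀ)) = 0 := by
  rw [integral_gaussian_eq m hC (by fun_prop), integral_gaussian_zero_one]
  refine mul_eq_zero_of_right _ (self_eq_neg.1 ?_)
  rw [← integral_neg, ← integral_neg_eq_self]
  refine integral_congr_ae (ae_of_all _ fun x => ?_)
  simp [matVec_eq_toEuclideanCLM]

variable {U : Vec d → ℝ} {L : ℝ}

lemma norm_gradient_le (hlip : ∀ x y, ‖gradient U x - gradient U y‖ ≤ L * ‖x - y‖) (x : Vec d) :
    ‖gradient U x‖ ≤ (‖gradient U 0‖ + |L|) * (1 + ‖x‖) := by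
  have h1 := norm_le_insert' (gradient U x) (gradient U 0)
  have h2 := hlip x 0
  rw [sub_zero] at h2
  nlinarith [mul_nonneg (norm_nonneg (gradient U 0)) (norm_nonneg x), abs_nonneg L,
    mul_le_mul_of_nonneg_right (le_abs_self L) (norm_nonneg x)]

lemma norm_fderiv_fderiv_le (hL : 0 ≤ L)
    (hlip : ∀ x y, ‖gradient U x - gradient U y‖ ≤ L * ‖x - y‖) (x : Vec d) :
    ‖fderiv ℝ (fderiv ℝ U) x‖ ≤ L := by
  have : LipschitzWith L.toNNReal (fderiv ℝ U) := LipschitzWith.of_dist_le_mul fun x y => by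
    rw [← toDual_gradient, ← toDual_gradient, LinearIsometryEquiv.dist_map, dist_eq_norm,
      dist_eq_norm, Real.coe_toNNReal _ hL]
    exact hlip x y
  simpa [hL] using norm_fderiv_le_of_lipschitz ℝ this (x₀ := x)

lemma abs_hess_apply_le (hU : ContDiff ℝ 2 U) (hL : 0 ≤ L)
    (hlip : ∀ x y, ‖gradient U x - gradient U y‖ ≤ L * ‖x - y‖) (x : Vec d) (i j : Fin d) :
    |hess U x i j| ≤ L := by
  rw [hess_apply hU, ← Real.norm_eq_abs]
  refine ((fderiv ℝ (fderiv ℝ U) x).le_opNorm₂ _ _).trans ?_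
  simpa using norm_fderiv_fderiv_le hL hlip x

lemma integrable_hess_apply (hU : ContDiff ℝ 2 U) (hL : 0 ≤ L)
    (hlip : ∀ x y, ‖gradient U x - gradient U y‖ ≤ L * ‖x - y‖) (m : Vec d) {C : Mat d}
    (hC : C.det ≠ 0) (i j : Fin d) :
    Integrable (fun x => hess U x i j) (gaussian m (C * Cᵀ)) := by
  refine integrable_gaussian m hC (K := L) ((continuous_hess hU).matrix_elem i j) fun x =>
    (abs_hess_apply_le hU hL hlip x i j).trans ?_
  nlinarith [mul_nonneg hL (sq_nonneg ‖x‖)]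

/-- Integration commutes with `H ↦ tr(AHB)`. -/
lemma integral_trace_mul_hess_mul (hU : ContDiff ℝ 2 U) (hL : 0 ≤ L)
    (hlip : ∀ x y, ‖gradient U x - gradient U y‖ ≤ L * ‖x - y‖) (m : Vec d) {C : Mat d}
    (hC : C.det ≠ 0) (A B : Mat d) :
    Integrable (fun x => (A * hess U x * B).trace) (gaussian m (C * Cᵀ)) ∧
    ∫ x, (A * hess U x * B).trace ∂(gaussian m (C * Cᵀ)) =
      (A * intHess U (gaussian m (C * Cᵀ)) * B).trace := by
  have hint (i j k : Fin d) :
      Integrable (fun x => A i k * hess U x k j * B j i) (gaussian m (C * Cᵀ)) :=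
    ((integrable_hess_apply hU hL hlip m hC k j).const_mul _).mul_const _
  simp only [Matrix.trace, Matrix.diag, Matrix.mul_apply, Finset.sum_mul]
  refine ⟨integrable_finsetSum _ fun i _ => integrable_finsetSum _ fun j _ =>
    integrable_finsetSum _ fun k _ => hint i j k, ?_⟩
  rw [integral_finsetSum _ fun i _ => integrable_finsetSum _ fun j _ =>
    integrable_finsetSum _ fun k _ => hint i j k]
  refine Finset.sum_congr rfl fun i _ => ?_
  rw [integral_finsetSum _ fun j _ => integrable_finsetSum _ fun k _ => hint i j k]
  refine Finset.sum_congr rfl fun j _ => ?_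
  rw [integral_finsetSum _ fun k _ => hint i j k]
  refine Finset.sum_congr rfl fun k _ => ?_
  rw [integral_mul_const, integral_const_mul]
  rfl

lemma trace_transpose_mul_hess_mul (hU : ContDiff ℝ 2 U) (C : Mat d) (x : Vec d) :
    (Cᵀ * hess U x * C).trace = ∑ i, fderiv ℝ (fderiv ℝ U) x
      (matVec C (EuclideanSpace.single i 1)) (matVec C (EuclideanSpace.single i 1)) := by
  rw [Matrix.mul_assoc]
  refine Finset.sum_congr rfl fun i _ => ?_
  have hcol : C *ᵥ (EuclideanSpace.single i (1 : ℝ)).ofLp = fun j => C j i := by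
    ext j
    simp [mulVec, dotProduct]
  rw [← dotProduct_hess hU, ofLp_matVec, hcol]
  simp only [Matrix.diag, Matrix.mul_apply, dotProduct, mulVec, Matrix.transpose_apply]

/-- Price's theorem in trace form for the Gaussian `N(m, CCᵀ)`. -/
lemma stein_gradient (hU : ContDiff ℝ 2 U) (hL : 0 ≤ L)
    (hlip : ∀ x y, ‖gradient U x - gradient U y‖ ≤ L * ‖x - y‖) (m : Vec d) {C : Mat d}
    (hC : C.det ≠ 0) :
    ∫ x, ⟪gradient U x, x - m⟫ ∂(gaussian m (C * Cᵀ)) =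
      ∫ x, (Cᵀ * hess U x * C).trace ∂(gaussian m (C * Cᵀ)) := by
  set A := Matrix.toEuclideanCLM (n := Fin d) (𝕜 := ℝ) C with hA
  have hT : Continuous fun e => matVec C e + m := (continuous_matVec C).add continuous_const
  have hgrad := continuous_gradient hU
  have hhess := continuous_hess hU
  have hU1 : ContDiff ℝ 1 (fderiv ℝ U) := hU.fderiv_right (by norm_num)
  set f : Fin d → Vec d → ℝ := fun i e =>
    fderiv ℝ U (A e + m) (A (EuclideanSpace.single i 1)) with hf
  have hf1 (i) : ContDiff ℝ 1 (f i) :=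
    (hU1.comp (A.contDiff.add contDiff_const)).clm_apply contDiff_const
  have hfd (i) (e : Vec d) : fderiv ℝ (f i) e (EuclideanSpace.single i 1) =
      fderiv ℝ (fderiv ℝ U) (A e + m) (A (EuclideanSpace.single i 1))
        (A (EuclideanSpace.single i 1)) := by
    have h := ((hU1.differentiable one_ne_zero (A e + m)).hasFDerivAt.comp e
      (A.hasFDerivAt.add_const m)).clm_apply
      (hasFDerivAt_const (A (EuclideanSpace.single i 1)) e)
    rw [show fderiv ℝ (f i) e = _ from h.fderiv]
    simp
  have hgrowth (i) (e : Vec d) :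
      |f i e| ≤ (‖gradient U m‖ + L * ‖A‖) * ‖A (EuclideanSpace.single i 1)‖ * (1 + ‖e‖) := by
    have h1 : ‖gradient U (A e + m)‖ ≤ (‖gradient U m‖ + L * ‖A‖) * (1 + ‖e‖) := by
      have h2 := norm_le_insert' (gradient U (A e + m)) (gradient U m)
      have h3 := hlip (A e + m) m
      rw [add_sub_cancel_right] at h3
      have h4 := mul_le_mul_of_nonneg_left (A.le_opNorm e) hL
      nlinarith [mul_nonneg (norm_nonneg (gradient U m)) (norm_nonneg e),
        mul_nonneg hL (norm_nonneg A)]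
    simp only [hf, ← inner_gradient]
    refine (abs_real_inner_le_norm _ _).trans ?_
    rw [mul_right_comm]
    gcongr
  have hbound (i) (e : Vec d) : |fderiv ℝ (f i) e (EuclideanSpace.single i 1)| ≤
      L * ‖A (EuclideanSpace.single i 1)‖ * ‖A (EuclideanSpace.single i 1)‖ := by
    rw [hfd, ← Real.norm_eq_abs]
    refine ((fderiv ℝ (fderiv ℝ U) (A e + m)).le_opNorm₂ _ _).trans ?_
    gcongr
    exact norm_fderiv_fderiv_le hL hlip _
  have hint1 (i) : Integrable (fun e => f i e * ⟪EuclideanSpace.single i (1 : ℝ), e⟫)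
      (gaussian (0 : Vec d) 1) := by
    exact integrable_gaussian_zero_one ((hf1 i).continuous.mul (by fun_prop))
      (abs_mul_inner_le (hgrowth i) _)
  have hint2 (i) : Integrable (fun e => fderiv ℝ (f i) e (EuclideanSpace.single i 1))
      (gaussian (0 : Vec d) 1) := by
    refine integrable_gaussian_zero_one
      (((hf1 i).continuous_fderiv one_ne_zero).clm_apply continuous_const) fun e =>
        (hbound i e).trans (le_mul_of_one_le_right (by positivity) ?_)
    nlinarith [sq_nonneg ‖e‖]
  rw [integral_gaussian_eq m hC (by fun_prop), integral_gaussian_eq m hC (by fun_prop)]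
  calc ∫ e, ⟪gradient U (matVec C e + m), matVec C e + m - m⟫ ∂(gaussian (0 : Vec d) 1)
      = ∫ e, ∑ i, f i e * ⟪EuclideanSpace.single i (1 : ℝ), e⟫ ∂(gaussian (0 : Vec d) 1) := by
        refine integral_congr_ae (ae_of_all _ fun e => ?_)
        simp only [add_sub_cancel_right, inner_gradient, hf]
        have he : e = ∑ i, e.ofLp i • EuclideanSpace.single i (1 : ℝ) := by
          simpa using ((EuclideanSpace.basisFun (Fin d) ℝ).sum_repr e).symm
        conv_lhs => enter [2]; rw [he, matVec_eq_toEuclideanCLM, map_sum]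
        rw [map_sum]
        refine Finset.sum_congr rfl fun i _ => ?_
        rw [map_smul, map_smul, smul_eq_mul, mul_comm]
        simp [EuclideanSpace.inner_single_left, matVec_eq_toEuclideanCLM, hA]
    _ = ∑ i, ∫ e, fderiv ℝ (f i) e (EuclideanSpace.single i 1) ∂(gaussian (0 : Vec d) 1) := by
        rw [integral_finsetSum _ fun i _ => hint1 i]
        exact Finset.sum_congr rfl fun i _ =>
          stein_gaussian_zero_one (hf1 i) (hgrowth i) (hbound i)
    _ = ∫ e, (Cᵀ * hess U (matVec C e + m) * C).trace ∂(gaussian (0 : Vec d) 1) := by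
        rw [← integral_finsetSum _ fun i _ => hint2 i]
        refine integral_congr_ae (ae_of_all _ fun e => ?_)
        simp only [hfd, trace_transpose_mul_hess_mul hU]
        rfl

end LinearGrowth

section Frobenius

lemma frobSq_eq_trace (A : Mat d) : frobSq A = (A * Aᵀ).trace := by
  simp [frobSq, Matrix.trace, Matrix.mul_apply, sq]

lemma frobSq_sub_le (A B : Mat d) : frobSq (A - B) ≤ 2 * frobSq A + 2 * frobSq B := by
  simp only [frobSq, Finset.mul_sum, ← Finset.sum_add_distrib]
  gcongr with i _ j _
  rw [Matrix.sub_apply]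
  nlinarith [sq_nonneg (A i j + B i j)]

lemma frobSq_nonneg (A : Mat d) : 0 ≤ frobSq A := by unfold frobSq; positivity

lemma frobSq_transpose_mul_le {L : ℝ} (hL : 0 < L) (C : Mat d) {H : Mat d} (hH : H.PosSemidef)
    (hHL : (L • (1 : Mat d) - H).PosSemidef) :
    frobSq (Cᵀ * H) ≤ L * (Cᵀ * H * C).trace := by
  have hT : Hᵀ = H := (conjTranspose_eq_transpose_of_trivial H).symm.trans hH.isHermitian
  have hT' : (L • (1 : Mat d) - H)ᵀ = L • (1 : Mat d) - H :=
    (conjTranspose_eq_transpose_of_trivial _).symm.trans hHL.isHermitian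
  have h1 := (hHL.conjTranspose_mul_mul_same H).add
    (hH.conjTranspose_mul_mul_same (L • (1 : Mat d) - H))
  simp only [conjTranspose_eq_transpose_of_trivial, hT, hT'] at h1
  have h2 : H * (L • (1 : Mat d) - H) * H + (L • (1 : Mat d) - H) * H * (L • (1 : Mat d) - H) =
      L • (L • H - H * H) := by
    simp only [Matrix.mul_sub, Matrix.sub_mul, Matrix.smul_mul, Matrix.mul_smul, Matrix.one_mul,
      Matrix.mul_one, smul_sub]
    abel
  rw [h2] at h1
  have h3 := (h1.conjTranspose_mul_mul_same C).trace_nonneg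
  have h4 : (Cᴴ * (L • (L • H - H * H)) * C).trace =
      L * (L * (Cᵀ * H * C).trace - frobSq (Cᵀ * H)) := by
    rw [frobSq_eq_trace, Matrix.transpose_mul, transpose_transpose, hT]
    simp only [conjTranspose_eq_transpose_of_trivial, Matrix.mul_sub, Matrix.sub_mul,
      Matrix.smul_mul, Matrix.mul_smul, trace_smul, trace_sub, smul_eq_mul, Matrix.mul_assoc]
  rw [h4] at h3
  linarith [nonneg_of_mul_nonneg_right h3 hL]

lemma transpose_mul_inv_mul_self {C : Mat d} (hC : C.det ≠ 0) :
    Cᵀ * (C * Cᵀ)⁻¹ = C⁻¹ := by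
  rw [Matrix.mul_inv_rev, ← Matrix.mul_assoc, mul_nonsing_inv _ (by simpa using hC), Matrix.one_mul]

lemma frobSq_inv {C : Mat d} : frobSq C⁻¹ = ((C * Cᵀ)⁻¹).trace := by
  rw [frobSq_eq_trace, trace_mul_comm, Matrix.mul_inv_rev, transpose_nonsing_inv]

end Frobenius
section Coupling

variable {ψ : Measure (Vec d × Vec d)} {p q : Measure (Vec d)} {f : Vec d → ℝ}

lemma IsCoupling.integrable_fst (h : IsCoupling ψ p q) (hf : Integrable f p) :
    Integrable (fun z => f z.1) ψ :=
  Integrable.comp_measurable (h.2.1 ▸ hf) measurable_fst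

lemma IsCoupling.integrable_snd (h : IsCoupling ψ p q) (hf : Integrable f q) :
    Integrable (fun z => f z.2) ψ :=
  Integrable.comp_measurable (h.2.2 ▸ hf) measurable_snd

lemma IsCoupling.integral_fst (h : IsCoupling ψ p q) (hf : Continuous f) :
    ∫ z, f z.1 ∂ψ = ∫ x, f x ∂p := by
  rw [← h.2.1, integral_map measurable_fst.aemeasurable hf.aestronglyMeasurable]

lemma IsCoupling.integral_snd (h : IsCoupling ψ p q) (hf : Continuous f) :
    ∫ z, f z.2 ∂ψ = ∫ x, f x ∂q := by
  rw [← h.2.2, integral_map measurable_snd.aemeasurable hf.aestronglyMeasurable]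

end Coupling

section HessianBounds

variable {U : Vec d → ℝ} {μ L : ℝ}

lemma dotProduct_self_eq_norm_sq (v : Vec d) : v.ofLp ⬝ᵥ v.ofLp = ‖v‖ ^ 2 := by
  rw [← real_inner_self_eq_norm_sq, EuclideanSpace.inner_eq_star_dotProduct, star_trivial]

lemma le_fderiv_fderiv (hU : ContDiff ℝ 2 U) {x : Vec d} (h : (hess U x - μ • 1).PosSemidef)
    (v : Vec d) : μ * ‖v‖ ^ 2 ≤ fderiv ℝ (fderiv ℝ U) x v v := by
  have := h.dotProduct_mulVec_nonneg v.ofLp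
  rw [star_trivial, sub_mulVec, dotProduct_sub, dotProduct_hess hU, smul_mulVec, one_mulVec,
    dotProduct_smul, dotProduct_self_eq_norm_sq, smul_eq_mul] at this
  linarith

lemma fderiv_fderiv_le (hU : ContDiff ℝ 2 U) {x : Vec d}
    (h : (L • (1 : Mat d) - hess U x).PosSemidef) (v : Vec d) :
    fderiv ℝ (fderiv ℝ U) x v v ≤ L * ‖v‖ ^ 2 := by
  have := h.dotProduct_mulVec_nonneg v.ofLp
  rw [star_trivial, sub_mulVec, dotProduct_sub, dotProduct_hess hU, smul_mulVec, one_mulVec,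
    dotProduct_smul, dotProduct_self_eq_norm_sq, smul_eq_mul] at this
  linarith

lemma lipschitz_gradient (hL : 0 < L) (hbelow : ∀ x y, 0 ≤ bregman U x y)
    (habove : ∀ x y, bregman U x y ≤ L / 2 * ‖x - y‖ ^ 2) (x y : Vec d) :
    ‖gradient U x - gradient U y‖ ≤ L * ‖x - y‖ := by
  refine le_of_sq_le_sq ?_ (by positivity)
  calc ‖gradient U x - gradient U y‖ ^ 2 ≤ 2 * L * bregman U x y :=
        bregman_cocoercive hL hbelow habove x y
    _ ≤ 2 * L * (L / 2 * ‖x - y‖ ^ 2) := by gcongr; exact habove x y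
    _ = _ := by ring

lemma continuous_bregman (hU : ContDiff ℝ 2 U) :
    Continuous fun p : Vec d × Vec d => bregman U p.1 p.2 := by
  have := hU.continuous
  have := continuous_gradient hU
  unfold bregman
  fun_prop

end HessianBounds

/-- **Variance bound for the Bonnet–Price parameter gradient estimator**
(Lemma 3.4).  With `q_λ = N(m, CCᵀ)` for `λ = (m,C) ∈ Λ`, stationarity of
`q_{λ_*} = N(m_*, C_*C_*ᵀ)`, any coupling `ψ` of `q_λ` and `q_{λ_*}`, and
`κ = L/μ`:
`E_{ε∼N(0,I)}[‖∇U(Cε+m) − ∫∇U dq_{λ_*}‖² + ‖Cᵀ∇²U(Cε+m) − C_*ᵀ∫∇²U dq_{λ_*}‖_F²]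
   ≤ 10Lκ·∫ D_U dψ + 10dL`. -/
theorem bonnet_price_param_gradient_variance_bound
    (d : ℕ) (hd : 0 < d) (U : Vec d → ℝ) (μ L : ℝ) (hμ : 0 < μ) (hμL : μ ≤ L)
    (hU : ContDiff ℝ 2 U)
    (hconv : ∀ x : Vec d,
      (hess U x - μ • 1).PosSemidef ∧ ((L • (1 : Mat d)) - hess U x).PosSemidef)
    (m : Vec d) (C : Mat d) (hlam : memLambda m C)
    (mstar : Vec d) (Cstar : Mat d) (hlamstar : memLambda mstar Cstar)
    (hstat1 : intGrad U (gaussian mstar (Cstar * Cstarᵀ)) = 0)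
    (hstat2 : intHess U (gaussian mstar (Cstar * Cstarᵀ)) = (Cstar * Cstarᵀ)⁻¹)
    (ψ : Measure (Vec d × Vec d))
    (hψ : IsCoupling ψ (gaussian m (C * Cᵀ)) (gaussian mstar (Cstar * Cstarᵀ))) :
    (∫ e, (‖gradient U (matVec C e + m) -
              intGrad U (gaussian mstar (Cstar * Cstarᵀ))‖ ^ 2 +
            frobSq (Cᵀ * hess U (matVec C e + m) -
              Cstarᵀ * intHess U (gaussian mstar (Cstar * Cstarᵀ))))
        ∂(gaussian (0 : Vec d) (1 : Mat d)))
      ≤ 10 * L * (L / μ) * (∫ p, bregman U p.1 p.2 ∂ψ) + 10 * d * L := by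
  have hL : 0 < L := hμ.trans_le hμL
  have hC := det_ne_zero_of_memLambda hlam
  have hCs := det_ne_zero_of_memLambda hlamstar
  have hlow := bregman_lower_bound hU fun x => le_fderiv_fderiv hU (hconv x).1
  have hup := bregman_upper_bound hU fun x => fderiv_fderiv_le hU (hconv x).2
  have hbreg (x y : Vec d) : 0 ≤ bregman U x y := (by positivity : (0 : ℝ) ≤ _).trans (hlow x y)
  have hlip := lipschitz_gradient hL hbreg hup
  have hgrad := continuous_gradient hU
  have hhess := continuous_hess hU
  have hgrowth := norm_gradient_le hlip
  have hpsd (x : Vec d) : (hess U x).PosSemidef := by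
    simpa using (hconv x).1.add (PosSemidef.one.smul hμ.le)
  have := hψ.1
  set q := gaussian m (C * Cᵀ) with hq
  set r := gaussian mstar (Cstar * Cstarᵀ) with hr
  have : IsProbabilityMeasure r := by
    rw [← hψ.2.2]
    exact Measure.isProbabilityMeasure_map measurable_snd.aemeasurable
  have : IsProbabilityMeasure q := by
    rw [← hψ.2.1]
    exact Measure.isProbabilityMeasure_map measurable_fst.aemeasurable
  have htrace : frobSq (Cstarᵀ * (Cstar * Cstarᵀ)⁻¹) ≤ d * L := by
    have h := integral_trace_mul_hess_mul hU hL.le hlip mstar hCs 1 1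
    simp only [Matrix.one_mul, Matrix.mul_one, ← hr] at h
    rw [transpose_mul_inv_mul_self hCs, frobSq_inv, ← hstat2, ← h.2]
    calc ∫ x, (hess U x).trace ∂r ≤ ∫ _, d * L ∂r := by
          refine integral_mono h.1 (integrable_const _) fun x => ?_
          have := (hconv x).2.trace_nonneg
          simp only [trace_sub, trace_smul, trace_one, Fintype.card_fin, smul_eq_mul] at this
          linarith
      _ = d * L := by simp
  have hsteinr : ∫ y, ⟪gradient U y, y - mstar⟫ ∂r = d := by
    rw [stein_gradient hU hL.le hlip mstar hCs,
      (integral_trace_mul_hess_mul hU hL.le hlip mstar hCs _ _).2,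
      ← hr, hstat2, transpose_mul_inv_mul_self hCs,
      nonsing_inv_mul _ (isUnit_iff_ne_zero.2 hCs), trace_one, Fintype.card_fin]
  have hgradr : Integrable (gradient U) r := by
    rw [← integrable_norm_iff hgrad.aestronglyMeasurable]
    refine integrable_gaussian mstar hCs (K := 2 * (‖gradient U 0‖ + |L|)) hgrad.norm fun x => ?_
    rw [abs_norm, mul_comm 2, mul_assoc]
    refine (hgrowth x).trans (mul_le_mul_of_nonneg_left ?_ (by positivity))
    nlinarith [sq_nonneg (‖x‖ - 1)]
  have hcrossr : ∫ y, ⟪gradient U mstar, gradient U y⟫ ∂r = 0 := by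
    rw [integral_inner hgradr, ← intGrad, hstat1, inner_zero_right]
  have hnormq : Integrable (fun x => ‖gradient U x‖ ^ 2) q := by
    simpa only [real_inner_self_eq_norm_sq] using
      integrable_inner_gaussian m hC hgrad hgrad hgrowth hgrowth
  have hinnq : Integrable (fun x => ⟪gradient U x, x - m⟫) q :=
    integrable_inner_gaussian m hC hgrad (by fun_prop) hgrowth (norm_sub_const_le m)
  have htrq := (integral_trace_mul_hess_mul hU hL.le hlip m hC Cᵀ C).1
  have hadd : Integrable (fun x => ‖gradient U x‖ ^ 2 + 2 * L * (Cᵀ * hess U x * C).trace) q :=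
    hnormq.add (htrq.const_mul _)
  have hestimator : (∫ e, (‖gradient U (matVec C e + m) - intGrad U r‖ ^ 2 +
      frobSq (Cᵀ * hess U (matVec C e + m) - Cstarᵀ * intHess U r)) ∂(gaussian (0 : Vec d) 1)) ≤
      ∫ x, (‖gradient U x‖ ^ 2 + 2 * L * (Cᵀ * hess U x * C).trace + 2 * (d * L)) ∂q := by
    have hT : Continuous fun e => matVec C e + m := (continuous_matVec C).add continuous_const
    rw [hq, integral_gaussian_eq m hC (by fun_prop)]
    refine integral_mono_of_nonneg
      (ae_of_all _ fun e => add_nonneg (sq_nonneg _) (frobSq_nonneg _)) ?_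
      (ae_of_all _ fun e => ?_)
    · refine Integrable.comp_measurable (g := fun x => ‖gradient U x‖ ^ 2 +
        2 * L * (Cᵀ * hess U x * C).trace + 2 * (d * L)) ?_ hT.measurable
      rw [map_gaussian m hC]
      exact hadd.add (integrable_const _)
    · simp only [hstat1, hstat2, sub_zero]
      have h1 := frobSq_sub_le (Cᵀ * hess U (matVec C e + m)) (Cstarᵀ * (Cstar * Cstarᵀ)⁻¹)
      have h2 := frobSq_transpose_mul_le hL C (hpsd (matVec C e + m)) (hconv _).2
      linarith
  have hreduce : ∫ x, (‖gradient U x‖ ^ 2 + 2 * L * (Cᵀ * hess U x * C).trace + 2 * (d * L)) ∂q =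
      ∫ p, (‖gradient U p.1‖ ^ 2 + 2 * L * ⟪gradient U p.1, p.1 - m⟫) ∂ψ + 2 * (d * L) := by
    rw [hψ.integral_fst (f := fun x => ‖gradient U x‖ ^ 2 + 2 * L * ⟪gradient U x, x - m⟫)
      (by fun_prop), integral_add hadd (integrable_const _),
      integral_add hnormq (htrq.const_mul _), integral_add hnormq (hinnq.const_mul _),
      integral_const_mul (2 * L), integral_const_mul (2 * L),
      stein_gradient hU hL.le hlip m hC, ← hq]
    simp
  have hsqnorm (n : Vec d) {B : Mat d} (hB : B.det ≠ 0) :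
      Integrable (fun x => ‖x‖ ^ 2) (gaussian n (B * Bᵀ)) :=
    integrable_gaussian n hB (K := 1) (by fun_prop) fun x => by
      rw [abs_of_nonneg (sq_nonneg _)]
      linarith
  have hD : Integrable (fun p => bregman U p.1 p.2) ψ := by
    refine Integrable.mono' (((hψ.integrable_fst (hsqnorm m hC)).add
      (hψ.integrable_snd (hsqnorm mstar hCs))).const_mul L)
      (continuous_bregman hU).aestronglyMeasurable (ae_of_all _ fun p => ?_)
    rw [Real.norm_eq_abs, abs_of_nonneg (hbreg _ _)]
    have h1 : ‖p.1 - p.2‖ ^ 2 ≤ 2 * (‖p.1‖ ^ 2 + ‖p.2‖ ^ 2) := by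
      have h2 := norm_sub_sq_real p.1 p.2
      have h3 := norm_add_sq_real p.1 p.2
      nlinarith [sq_nonneg ‖p.1 + p.2‖]
    calc bregman U p.1 p.2 ≤ L / 2 * ‖p.1 - p.2‖ ^ 2 := hup _ _
      _ ≤ L / 2 * (2 * (‖p.1‖ ^ 2 + ‖p.2‖ ^ 2)) := by gcongr
      _ = _ := by simp only [Pi.add_apply]; ring
  have hs := hψ.integrable_snd (integrable_inner_gaussian mstar hCs hgrad
    (v := fun y => y - mstar) (by fun_prop) hgrowth (norm_sub_const_le mstar))
  have ht := hψ.integrable_snd (integrable_inner_gaussian mstar hCs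
    (u := fun _ => gradient U mstar) (v := fun y => y - mstar) (by fun_prop) (by fun_prop)
    (norm_const_le _) (norm_sub_const_le mstar))
  have hc := hψ.integrable_snd (integrable_inner_gaussian mstar hCs
    (u := fun _ => gradient U mstar) (by fun_prop) hgrad (norm_const_le _) hgrowth)
  have hw1 := hψ.integrable_fst (integrable_inner_gaussian m hC
    (u := fun _ => m - mstar) (v := fun y => y - m) (by fun_prop) (by fun_prop)
    (norm_const_le _) (norm_sub_const_le m))
  have hw2 := hψ.integrable_snd (integrable_inner_gaussian mstar hCs
    (u := fun _ => m - mstar) (v := fun y => y - mstar) (by fun_prop) (by fun_prop)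
    (norm_const_le _) (norm_sub_const_le mstar))
  have hbound : ∫ p, (‖gradient U p.1‖ ^ 2 + 2 * L * ⟪gradient U p.1, p.1 - m⟫) ∂ψ ≤
      10 * L * (L / μ) * (∫ p, bregman U p.1 p.2 ∂ψ) + 8 * L * d := by
    have h1 := hD.const_mul (10 * L * (L / μ))
    have h2 := h1.add (hs.const_mul (8 * L))
    have h3 := h2.sub (ht.const_mul (6 * L))
    have h4 := h3.add (hc.const_mul 8)
    have h5 := (hw1.sub hw2).const_mul (3 * L ^ 2)
    refine (integral_mono ((hψ.integrable_fst hnormq).add ((hψ.integrable_fst hinnq).const_mul _))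
      (h4.sub h5) fun p => gradient_pointwise_bound hμ hμL hlow hup m mstar p.1 p.2).trans_eq ?_
    rw [integral_sub' h4 h5, integral_add' h3 (hc.const_mul 8), integral_sub' h2 (ht.const_mul _),
      integral_add' h1 (hs.const_mul _)]
    simp only [Pi.sub_apply, integral_const_mul]
    rw [integral_sub hw1 hw2,
      hψ.integral_snd (f := fun y => ⟪gradient U y, y - mstar⟫) (by fun_prop),
      hψ.integral_snd (f := fun y => ⟪gradient U mstar, y - mstar⟫) (by fun_prop),
      hψ.integral_snd (f := fun y => ⟪gradient U mstar, gradient U y⟫) (by fun_prop),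
      hψ.integral_fst (f := fun x => ⟪m - mstar, x - m⟫) (by fun_prop),
      hψ.integral_snd (f := fun y => ⟪m - mstar, y - mstar⟫) (by fun_prop),
      hsteinr, hcrossr, integral_inner_sub_gaussian _ _ hCs, integral_inner_sub_gaussian _ _ hC,
      integral_inner_sub_gaussian _ _ hCs]
    ring
  rw [hreduce] at hestimator
  linarith
end
end

section
/- Parameter-space Bregman divergence identity (Lemma 3.6): Define the parameter-space energy ℰ(m, C) = E_{ε∼N(0,I)}[ U(Cε + m) ] for (m,C) ∈ ℝ^d × ℝ^{d×d}. Then ℰ is Fréchet differentiable, its derivative at (m', C') in direction (δm, δC) equals E_{ε∼N(0,I)}⟨ ∇U(C'ε + m'), δC·ε + δm ⟩, and for all λ = (m,C) and λ' = (m',C') in Λ: E_{ε∼N(0,I)}[ D_U( Cε + m, C'ε + m' ) ] = ℰ(λ) − ℰ(λ') − E_{ε∼N(0,I)}⟨ ∇U(C'ε + m'), (C − C')ε + (m − m') ⟩; that is, the expected Bregman divergence of U under the reparametrization coupling equals the Bregman divergence of ℰ between λ and λ'. -/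
open MeasureTheory Matrix Real
open scoped RealInnerProductSpace

noncomputable section

variable {d : ℕ}

/-- Norm on matrices, so that Fréchet differentiability on `ℝ^d × ℝ^{d×d}` makes
sense (all norms on a finite-dimensional space are equivalent, so the choice is
immaterial). -/
noncomputable instance : NormedAddCommGroup (Mat d) := Matrix.normedAddCommGroup
noncomputable instance : NormedSpace ℝ (Mat d) := Matrix.normedSpace

/-- The parameter-space energy `ℰ(m, C) = E_{ε∼N(0,I)}[U(Cε + m)]`. -/
def energy (U : Vec d → ℝ) (p : Vec d × Mat d) : ℝ :=
  ∫ e, U (matVec p.2 e + p.1) ∂(gaussian (0 : Vec d) (1 : Mat d))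

section LinearGrowth

variable {V : Type*} [NormedAddCommGroup V] [NormedSpace ℝ V] {U : V → ℝ} {A : ℝ}

/-- A function whose derivative grows at most linearly grows at most quadratically. -/
lemma abs_le_of_norm_fderiv_le_linear (hU : ContDiff ℝ 1 U) (hA : 0 ≤ A)
    (hgrow : ∀ x, ‖fderiv ℝ U x‖ ≤ A * (1 + ‖x‖)) (x : V) :
    |U x| ≤ |U 0| + A * (1 + ‖x‖) ^ 2 := by
  have hx := norm_nonneg x
  have key : ‖U x - U 0‖ ≤ A * (1 + ‖x‖) * ‖x - 0‖ := by
    refine (convex_closedBall (0 : V) ‖x‖).norm_image_sub_le_of_norm_fderiv_le (𝕜 := ℝ)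
      (fun y _ => (hU.differentiable one_ne_zero).differentiableAt) (fun y hy => ?_)
      (by simp) (by simp)
    have hy' : ‖y‖ ≤ ‖x‖ := by simpa using hy
    exact (hgrow y).trans (by gcongr)
  rw [sub_zero, Real.norm_eq_abs] at key
  have h1 : |U x| ≤ |U 0| + |U x - U 0| := by
    simpa using abs_add_le (U 0) (U x - U 0)
  nlinarith [mul_nonneg hA (add_nonneg zero_le_one hx)]

variable {E : Type*} [NormedAddCommGroup E] {P : Type*} [NormedAddCommGroup P] [NormedSpace ℝ P]
  {T : E → P →L[ℝ] V} {K : ℝ}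

lemma norm_fderiv_comp_le_of_linear_growth (hA : 0 ≤ A)
    (hgrow : ∀ x, ‖fderiv ℝ U x‖ ≤ A * (1 + ‖x‖)) (hK : 0 ≤ K)
    (hTK : ∀ e, ‖T e‖ ≤ K * (1 + ‖e‖)) {R : ℝ} {p : P} (hp : ‖p‖ ≤ R) (e : E) :
    ‖(fderiv ℝ U (T e p)).comp (T e)‖ ≤ A * (1 + K * R) * K * (1 + ‖e‖) ^ 2 := by
  have hTe : ‖T e p‖ ≤ K * (1 + ‖e‖) * ‖p‖ :=
    (T e).le_of_opNorm_le (hTK e) p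
  have he := norm_nonneg e
  have hTe' : ‖T e p‖ ≤ K * (1 + ‖e‖) * R := hTe.trans (by gcongr)
  calc ‖(fderiv ℝ U (T e p)).comp (T e)‖ ≤ ‖fderiv ℝ U (T e p)‖ * ‖T e‖ :=
        ContinuousLinearMap.opNorm_comp_le _ _
    _ ≤ (A * ((1 + K * R) * (1 + ‖e‖))) * (K * (1 + ‖e‖)) := by
        have h1 : 1 + ‖T e p‖ ≤ (1 + K * R) * (1 + ‖e‖) := by nlinarith
        have h2 : ‖fderiv ℝ U (T e p)‖ ≤ A * ((1 + K * R) * (1 + ‖e‖)) :=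
          (hgrow _).trans (by gcongr)
        exact mul_le_mul h2 (hTK e) (norm_nonneg _) ((norm_nonneg _).trans h2)
    _ = _ := by ring

variable [MeasurableSpace E] [BorelSpace E] {ν : Measure E}

/-- If `fderiv ℝ U` has linear growth, `U` is integrable along any family of linear images of
linear growth, provided second moments are finite. -/
lemma integrable_comp_of_linear_growth (hU : ContDiff ℝ 1 U) (hA : 0 ≤ A)
    (hgrow : ∀ x, ‖fderiv ℝ U x‖ ≤ A * (1 + ‖x‖)) (hT : Continuous T)
    (hTK : ∀ e, ‖T e‖ ≤ K * (1 + ‖e‖)) (hν : Integrable (fun e : E => (1 + ‖e‖) ^ 2) ν) (p : P) :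
    Integrable (fun e => U (T e p)) ν := by
  refine (hν.const_mul (|U 0| + A * (1 + K * ‖p‖) ^ 2)).mono'
    (hU.continuous.comp (hT.clm_apply continuous_const)).aestronglyMeasurable
    (.of_forall fun e => ?_)
  have hTe : ‖T e p‖ ≤ K * (1 + ‖e‖) * ‖p‖ :=
    (T e).le_of_opNorm_le (hTK e) p
  have he := norm_nonneg e
  have hp := norm_nonneg p
  calc ‖U (T e p)‖ ≤ |U 0| + A * (1 + ‖T e p‖) ^ 2 :=
        abs_le_of_norm_fderiv_le_linear hU hA hgrow _
    _ ≤ |U 0| * (1 + ‖e‖) ^ 2 + A * ((1 + K * ‖p‖) * (1 + ‖e‖)) ^ 2 := by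
        have h1 : 1 + ‖T e p‖ ≤ (1 + K * ‖p‖) * (1 + ‖e‖) := by nlinarith
        have h2 : (1 : ℝ) ≤ (1 + ‖e‖) ^ 2 := by nlinarith
        gcongr
        exact le_mul_of_one_le_right (abs_nonneg _) h2
    _ = _ := by ring

variable [SecondCountableTopology E]

lemma integrable_fderiv_comp_of_linear_growth (hU : ContDiff ℝ 1 U) (hA : 0 ≤ A)
    (hgrow : ∀ x, ‖fderiv ℝ U x‖ ≤ A * (1 + ‖x‖)) (hT : Continuous T) (hK : 0 ≤ K)
    (hTK : ∀ e, ‖T e‖ ≤ K * (1 + ‖e‖)) (hν : Integrable (fun e : E => (1 + ‖e‖) ^ 2) ν) (p : P) :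
    Integrable (fun e => (fderiv ℝ U (T e p)).comp (T e)) ν :=
  (hν.const_mul _).mono'
    (((hU.continuous_fderiv one_ne_zero).comp
      (hT.clm_apply continuous_const)).clm_comp hT).aestronglyMeasurable
    (.of_forall fun e => norm_fderiv_comp_le_of_linear_growth hA hgrow hK hTK le_rfl e)

/-- Differentiation under the integral sign for `p ↦ ∫ U (T e p)`. -/
lemma hasFDerivAt_integral_comp_of_linear_growth (hU : ContDiff ℝ 1 U) (hA : 0 ≤ A)
    (hgrow : ∀ x, ‖fderiv ℝ U x‖ ≤ A * (1 + ‖x‖)) (hT : Continuous T) (hK : 0 ≤ K)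
    (hTK : ∀ e, ‖T e‖ ≤ K * (1 + ‖e‖)) (hν : Integrable (fun e : E => (1 + ‖e‖) ^ 2) ν) (p : P) :
    HasFDerivAt (fun p => ∫ e, U (T e p) ∂ν)
      (∫ e, (fderiv ℝ U (T e p)).comp (T e) ∂ν) p := by
  refine hasFDerivAt_integral_of_dominated_of_fderiv_le
    (F := fun p e => U (T e p)) (F' := fun p e => (fderiv ℝ U (T e p)).comp (T e))
    (Metric.ball_mem_nhds p one_pos)
    (.of_forall fun q =>
      (integrable_comp_of_linear_growth hU hA hgrow hT hTK hν q).aestronglyMeasurable)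
    (integrable_comp_of_linear_growth hU hA hgrow hT hTK hν p)
    (integrable_fderiv_comp_of_linear_growth hU hA hgrow hT hK hTK hν p).aestronglyMeasurable
    (.of_forall fun e q hq =>
      norm_fderiv_comp_le_of_linear_growth hA hgrow hK hTK (R := ‖p‖ + 1) ?_ e)
    (hν.const_mul _) (.of_forall fun e q _ => ?_)
  · have hq' : ‖q - p‖ < 1 := by simpa [dist_eq_norm] using hq
    linarith [norm_le_norm_add_norm_sub' q p]
  · exact (hU.differentiable one_ne_zero _).hasFDerivAt.comp q (T e).hasFDerivAt

end LinearGrowth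

lemma integrable_one_add_norm_sq_gaussian :
    Integrable (fun e : Vec d => (1 + ‖e‖) ^ 2) (gaussian (0 : Vec d) (1 : Mat d)) := by
  have hmv : ∀ x : Vec d, matVec (1 : Mat d)⁻¹ x = x := fun x => by simp [matVec]
  have hmeas : Measurable fun x : Vec d =>
      ENNReal.ofReal (Real.sqrt (((2 * π) ^ d * (1 : Mat d).det)⁻¹) *
        Real.exp (-⟪x - 0, matVec (1 : Mat d)⁻¹ (x - 0)⟫ / 2)) := by
    simp only [hmv]
    fun_prop
  rw [gaussian, integrable_withDensity_iff_integrable_smul' hmeas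
    (.of_forall fun _ => ENNReal.ofReal_lt_top)]
  set c := Real.sqrt (((2 * π) ^ d * (1 : Mat d).det)⁻¹)
  have hc0 : 0 ≤ c := Real.sqrt_nonneg _
  have hg : Integrable (fun x : Vec d => Real.exp (-(1 / 4) * ‖x‖ ^ 2)) := by
    have h := (GaussianFourier.integrable_cexp_neg_mul_sq_norm_add (V := Vec d)
      (b := 1 / 4) (by norm_num) 0 0).norm
    refine h.congr (.of_forall fun x => ?_)
    simp only [Complex.norm_exp]
    congr 1
    simp [← Complex.ofReal_pow]
  refine (hg.const_mul (8 * c)).mono'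
    (hmeas.ennreal_toReal.aestronglyMeasurable.smul
      (by fun_prop : Continuous fun e : Vec d => (1 + ‖e‖) ^ 2).aestronglyMeasurable)
    (.of_forall fun x => ?_)
  rw [ENNReal.toReal_ofReal (by positivity), hmv, sub_zero, real_inner_self_eq_norm_sq,
    smul_eq_mul, Real.norm_of_nonneg (by positivity)]
  have h1 : (1 + ‖x‖) ^ 2 ≤ 8 * Real.exp (‖x‖ ^ 2 / 4) := by
    nlinarith [Real.add_one_le_exp (‖x‖ ^ 2 / 4), sq_nonneg (‖x‖ - 1)]
  calc c * Real.exp (-‖x‖ ^ 2 / 2) * (1 + ‖x‖) ^ 2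
      ≤ c * Real.exp (-‖x‖ ^ 2 / 2) * (8 * Real.exp (‖x‖ ^ 2 / 4)) := by gcongr
    _ = 8 * c * (Real.exp (-‖x‖ ^ 2 / 2) * Real.exp (‖x‖ ^ 2 / 4)) := by ring
    _ = 8 * c * Real.exp (-(1 / 4) * ‖x‖ ^ 2) := by
        rw [← Real.exp_add]; congr 2; ring

/-- The entries of a real matrix between `0` and `L • 1` are bounded by `L`. -/
lemma abs_entry_le_of_posSemidef {H : Mat d} {L : ℝ} (hH : H.PosSemidef)
    (hL : (L • (1 : Mat d) - H).PosSemidef) (i j : Fin d) : |H i j| ≤ L := by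
  have hdiag : ∀ k, H k k ≤ L := fun k => by
    simpa using hL.diag_nonneg (i := k)
  have hsymm : H j i = H i j := by simpa using hH.isHermitian.apply i j
  have h1 := hH.dotProduct_mulVec_nonneg (Pi.single i 1 + Pi.single j 1)
  have h2 := hH.dotProduct_mulVec_nonneg (Pi.single i 1 - Pi.single j 1)
  simp [mulVec_add, mulVec_sub, add_dotProduct, sub_dotProduct, hsymm] at h1 h2
  rw [abs_le]
  constructor <;> linarith [hdiag i, hdiag j]

lemma norm_clm_le_sum_single (f : Vec d →L[ℝ] ℝ) :
    ‖f‖ ≤ ∑ i, ‖f (EuclideanSpace.single i 1)‖ := by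
  refine f.opNorm_le_bound (Finset.sum_nonneg fun _ _ => norm_nonneg _) fun x => ?_
  have hx : x = ∑ i, x i • EuclideanSpace.single i (1 : ℝ) := by
    simpa using ((EuclideanSpace.basisFun (Fin d) ℝ).sum_repr x).symm
  calc ‖f x‖ = ‖∑ i, x i • f (EuclideanSpace.single i 1)‖ := by
        conv_lhs => rw [hx]
        simp
    _ ≤ ∑ i, ‖x i‖ * ‖f (EuclideanSpace.single i 1)‖ := by
        simpa only [norm_smul] using norm_sum_le Finset.univ
          (fun i => x i • f (EuclideanSpace.single i (1 : ℝ)))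
    _ ≤ ∑ i, ‖x‖ * ‖f (EuclideanSpace.single i 1)‖ := by
        gcongr with i
        exact PiLp.norm_apply_le x i
    _ = _ := by rw [← Finset.mul_sum, mul_comm]

/-- A bounded Hessian gives a derivative of linear growth. -/
lemma exists_norm_fderiv_le_of_hess_bounded {U : Vec d → ℝ} {L : ℝ} (hL : 0 ≤ L)
    (hU : ContDiff ℝ 2 U) (hH : ∀ x i j, |hess U x i j| ≤ L) :
    ∃ A, 0 ≤ A ∧ ∀ x, ‖fderiv ℝ U x‖ ≤ A * (1 + ‖x‖) := by
  have hcomp : ∀ j x, |fderiv ℝ U x (EuclideanSpace.single j 1)| ≤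
      |fderiv ℝ U 0 (EuclideanSpace.single j 1)| + d * L * ‖x‖ := fun j x => by
    have hdiff : Differentiable ℝ fun y => fderiv ℝ U y (EuclideanSpace.single j 1) :=
      ((hU.fderiv_right (m := 1) (by norm_num)).differentiable one_ne_zero).clm_apply
        (differentiable_const _)
    have h := convex_univ.norm_image_sub_le_of_norm_fderiv_le (𝕜 := ℝ) (C := d * L)
      (x := 0) (y := x) (fun y _ => hdiff y) (fun y _ => ?_) trivial trivial
    · rw [sub_zero, Real.norm_eq_abs] at h
      have h1 := abs_add_le (fderiv ℝ U 0 (EuclideanSpace.single j 1))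
        (fderiv ℝ U x (EuclideanSpace.single j 1) - fderiv ℝ U 0 (EuclideanSpace.single j 1))
      rw [add_sub_cancel] at h1
      linarith
    · refine (norm_clm_le_sum_single _).trans ((Finset.sum_le_sum fun i _ => hH y i j).trans ?_)
      simp
  refine ⟨(∑ j, |fderiv ℝ U 0 (EuclideanSpace.single j 1)|) + d * (d * L), by positivity,
    fun x => (norm_clm_le_sum_single _).trans ((Finset.sum_le_sum fun j _ => hcomp j x).trans ?_)⟩
  have hS : 0 ≤ ∑ j, |fderiv ℝ U 0 (EuclideanSpace.single j 1)| := by positivity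
  have hD : 0 ≤ d * (d * L) := by positivity
  simp only [Finset.sum_add_distrib, Finset.sum_const, Finset.card_univ, Fintype.card_fin,
    nsmul_eq_mul]
  nlinarith [norm_nonneg x]

lemma matVec_sub (A B : Mat d) (x : Vec d) : matVec (A - B) x = matVec A x - matVec B x := by
  simp [matVec, sub_mulVec]

/-- `matVec` as a continuous bilinear map, with matrices carrying the sup norm of functions. -/
def matVecL (d : ℕ) : (Fin d → Fin d → ℝ) →L[ℝ] Vec d →L[ℝ] Vec d :=
  (LinearMap.mk₂ ℝ (fun A x => matVec (Matrix.of A) x)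
    (fun A B x => by simp [matVec, ← of_add_of, add_mulVec])
    (fun c A x => by simp [matVec, ← smul_of, smul_mulVec])
    (fun A x y => by simp [matVec, mulVec_add])
    (fun c A x => by simp [matVec, mulVec_smul])).toContinuousBilinearMap

/-- The reparametrization `(m, C) ↦ Cε + m`, linear in the parameter. -/
def reparam (e : Vec d) : (Vec d × (Fin d → Fin d → ℝ)) →L[ℝ] Vec d :=
  ((matVecL d).flip e).comp (ContinuousLinearMap.snd ℝ (Vec d) (Fin d → Fin d → ℝ)) +
    ContinuousLinearMap.fst ℝ (Vec d) (Fin d → Fin d → ℝ)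

lemma continuous_reparam : Continuous (reparam (d := d)) :=
  ((matVecL d).flip.continuous.clm_comp continuous_const).add continuous_const

lemma norm_reparam_le (e : Vec d) : ‖reparam e‖ ≤ (‖matVecL d‖ + 1) * (1 + ‖e‖) := by
  have h1 : ‖(matVecL d).flip e‖ ≤ ‖matVecL d‖ * ‖e‖ := by
    simpa using (matVecL d).flip.le_opNorm e
  have h2 : ‖((matVecL d).flip e).comp (ContinuousLinearMap.snd ℝ (Vec d) (Fin d → Fin d → ℝ))‖ ≤
      ‖matVecL d‖ * ‖e‖ * 1 :=
    (ContinuousLinearMap.opNorm_comp_le _ _).trans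
      (mul_le_mul h1 (ContinuousLinearMap.norm_snd_le ℝ _ _) (norm_nonneg _) (by positivity))
  have h3 := ContinuousLinearMap.norm_fst_le ℝ (Vec d) (Fin d → Fin d → ℝ)
  have h4 : ‖reparam e‖ ≤ _ := norm_add_le _ _
  nlinarith [norm_nonneg e, norm_nonneg (matVecL d)]

/-- **Parameter-space Bregman divergence identity** (Lemma 3.6).  The energy
`ℰ` is Fréchet differentiable with derivative
`Dℰ(m',C')(δm,δC) = E⟨∇U(C'ε+m'), δCε+δm⟩`, and for all `λ, λ' ∈ Λ` the
expected Bregman divergence of `U` under the reparametrization coupling equals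
the Bregman divergence of `ℰ`. -/
theorem param_bregman_identity
    (d : ℕ) (hd : 0 < d) (U : Vec d → ℝ) (μ L : ℝ) (hμ : 0 < μ) (hμL : μ ≤ L)
    (hU : ContDiff ℝ 2 U)
    (hconv : ∀ x : Vec d,
      (hess U x - μ • 1).PosSemidef ∧ ((L • (1 : Mat d)) - hess U x).PosSemidef) :
    (∀ p : Vec d × Mat d, ∃ D : (Vec d × Mat d) →L[ℝ] ℝ,
        HasFDerivAt (energy U) D p ∧
        ∀ δ : Vec d × Mat d,
          D δ = ∫ e, ⟪gradient U (matVec p.2 e + p.1), matVec δ.2 e + δ.1⟫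
            ∂(gaussian (0 : Vec d) (1 : Mat d)))
    ∧ (∀ (m : Vec d) (C : Mat d) (m' : Vec d) (C' : Mat d),
        memLambda m C → memLambda m' C' →
        (∫ e, bregman U (matVec C e + m) (matVec C' e + m')
            ∂(gaussian (0 : Vec d) (1 : Mat d)))
          = energy U (m, C) - energy U (m', C')
            - ∫ e, ⟪gradient U (matVec C' e + m'),
                matVec (C - C') e + (m - m')⟫
              ∂(gaussian (0 : Vec d) (1 : Mat d))) := by
  obtain ⟨A, hA, hgrow⟩ := exists_norm_fderiv_le_of_hess_bounded (hμ.le.trans hμL) hU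
    fun x i j => by
      refine abs_entry_le_of_posSemidef ?_ (hconv x).2 i j
      simpa using (hconv x).1.add (PosSemidef.one.smul hμ.le)
  have hU1 : ContDiff ℝ 1 U := hU.of_le (by norm_num)
  have hK : 0 ≤ ‖matVecL d‖ + 1 := by positivity
  have hγ := integrable_one_add_norm_sq_gaussian (d := d)
  have hint := integrable_comp_of_linear_growth hU1 hA hgrow continuous_reparam
    norm_reparam_le hγ
  have hint' := integrable_fderiv_comp_of_linear_growth hU1 hA hgrow continuous_reparam hK
    norm_reparam_le hγ
  refine ⟨fun p => ⟨_, hasFDerivAt_integral_comp_of_linear_growth hU1 hA hgrow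
    continuous_reparam hK norm_reparam_le hγ p, fun δ => ?_⟩, fun m C m' C' _ _ => ?_⟩
  · refine (ContinuousLinearMap.integral_apply (hint' p) δ).trans ?_
    simp only [inner_gradient_left]
    rfl
  · have hE : ∀ (n : Vec d) (B : Mat d), Integrable (fun e => U (matVec B e + n))
        (gaussian (0 : Vec d) (1 : Mat d)) := fun n B => hint (n, B)
    have hD : Integrable (fun e => ⟪gradient U (matVec C' e + m'),
        matVec (C - C') e + (m - m')⟫) (gaussian (0 : Vec d) (1 : Mat d)) := by
      simp only [inner_gradient_left]
      exact (hint' (m', C')).apply_continuousLinearMap (m - m', C - C')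
    have hsub : ∀ e : Vec d, matVec C e + m - (matVec C' e + m') =
        matVec (C - C') e + (m - m') := fun e => by rw [matVec_sub]; abel
    simp only [bregman, hsub, energy]
    rw [integral_sub (by exact (hE m C).sub (hE m' C')) hD, integral_sub (hE m C) (hE m' C')]
end
end
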